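/- Let (M,·,1) be a monoid and let S be a naturally ordered ω-continuous M-module. Then for every M-wGCL program C, the transformer wp[C] is additive: for all weightings f, g, wp[C](f ⊕ g) = wp[C](f) ⊕ wp[C](g). -/

import Mathlib

/-! ## Monoid modules, natural order, ω-(co)continuity -/

structure MonModule (M : Type) [Monoid M] (S : Type) where
  add : S → S → S
  zero : S
  smul : M → S → S
  add_assoc : ∀ a b c : S, add (add a b) c = add a (add b c)
  add_comm : ∀ a b : S, add a b = add b a
  add_zero : ∀ a : S, add a zero = a
  smul_assoc : ∀ (u v : M) (a : S), smul (u * v) a = smul u (smul v a)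
  smul_add : ∀ (u : M) (a b : S), smul u (add a b) = add (smul u a) (smul u b)
  one_smul : ∀ a : S, smul 1 a = a
  smul_zero : ∀ u : M, smul u zero = zero

namespace MonModule

variable {M S : Type} [Monoid M]

/-- The natural (pre)order: `a ⪯ b` iff `∃ c, a ⊕ c = b`. -/
def le (mm : MonModule M S) (a b : S) : Prop := ∃ c : S, mm.add a c = b

/-- `S` is naturally ordered if the natural order is antisymmetric (hence a partial order). -/
def NaturallyOrdered (mm : MonModule M S) : Prop :=
  ∀ a b : S, mm.le a b → mm.le b a → a = b

/-- ω-chain (ascending). -/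
def Chain (mm : MonModule M S) (s : ℕ → S) : Prop := ∀ n : ℕ, mm.le (s n) (s (n + 1))

/-- ω-descending chain. -/
def DChain (mm : MonModule M S) (s : ℕ → S) : Prop := ∀ n : ℕ, mm.le (s (n + 1)) (s n)

/-- `x` is the supremum (least upper bound) of `s` w.r.t. the natural order. -/
def IsSup (mm : MonModule M S) (s : ℕ → S) (x : S) : Prop :=
  (∀ n : ℕ, mm.le (s n) x) ∧ ∀ y : S, (∀ n : ℕ, mm.le (s n) y) → mm.le x y

/-- `x` is the infimum (greatest lower bound) of `s` w.r.t. the natural order. -/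
def IsInf (mm : MonModule M S) (s : ℕ → S) (x : S) : Prop :=
  (∀ n : ℕ, mm.le x (s n)) ∧ ∀ y : S, (∀ n : ℕ, mm.le y (s n)) → mm.le y x

end MonModule

/-- `S` is ω-continuous: suprema of ω-chains exist (with least element `𝟘`, which is
automatically least for the natural order), and `⊕`, `⊗` are ω-continuous. -/
structure OmegaContinuous {M S : Type} [Monoid M] (mm : MonModule M S) : Prop where
  sup_exists : ∀ s : ℕ → S, mm.Chain s → ∃ x : S, mm.IsSup s x
  add_cont : ∀ (a : S) (s : ℕ → S) (x : S), mm.Chain s → mm.IsSup s x →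
    mm.IsSup (fun n => mm.add a (s n)) (mm.add a x)
  smul_cont : ∀ (u : M) (s : ℕ → S) (x : S), mm.Chain s → mm.IsSup s x →
    mm.IsSup (fun n => mm.smul u (s n)) (mm.smul u x)

/-- `S` is ω-cocontinuous: a greatest element exists, infima of ω-descending chains exist,
and `⊕`, `⊗` are ω-cocontinuous. -/
structure OmegaCocontinuous {M S : Type} [Monoid M] (mm : MonModule M S) : Prop where
  top_exists : ∃ t : S, ∀ a : S, mm.le a t
  inf_exists : ∀ s : ℕ → S, mm.DChain s → ∃ x : S, mm.IsInf s x
  add_cocont : ∀ (a : S) (s : ℕ → S) (x : S), mm.DChain s → mm.IsInf s x →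
    mm.IsInf (fun n => mm.add a (s n)) (mm.add a x)
  smul_cocont : ∀ (u : M) (s : ℕ → S) (x : S), mm.DChain s → mm.IsInf s x →
    mm.IsInf (fun n => mm.smul u (s n)) (mm.smul u x)

def OmegaBicontinuous {M S : Type} [Monoid M] (mm : MonModule M S) : Prop :=
  OmegaContinuous mm ∧ OmegaCocontinuous mm

/-! ## Weightings (pointwise lifting to `St → S`) -/

section Weightings

variable {M S St : Type} [Monoid M]

/-- Pointwise natural order on weightings. -/
def wle (mm : MonModule M S) (f g : St → S) : Prop := ∀ σ : St, mm.le (f σ) (g σ)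

def WChain (mm : MonModule M S) (s : ℕ → St → S) : Prop := ∀ n : ℕ, wle mm (s n) (s (n + 1))

def WDChain (mm : MonModule M S) (s : ℕ → St → S) : Prop := ∀ n : ℕ, wle mm (s (n + 1)) (s n)

def WIsSup (mm : MonModule M S) (s : ℕ → St → S) (x : St → S) : Prop :=
  (∀ n : ℕ, wle mm (s n) x) ∧ ∀ y : St → S, (∀ n : ℕ, wle mm (s n) y) → wle mm x y

def WIsInf (mm : MonModule M S) (s : ℕ → St → S) (x : St → S) : Prop :=
  (∀ n : ℕ, wle mm x (s n)) ∧ ∀ y : St → S, (∀ n : ℕ, wle mm y (s n)) → wle mm y x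

end Weightings

/-! ## wGCL syntax -/

/-- wGCL programs over weights from `M` and program states from `St`:
assignments (as state transformations), sequencing, conditionals, nondeterministic
branching, weighting `⊙ a`, and loops. -/
inductive WGCL (M : Type) (St : Type) : Type
  | assign : (St → St) → WGCL M St
  | seq : WGCL M St → WGCL M St → WGCL M St
  | ite : Set St → WGCL M St → WGCL M St → WGCL M St
  | branch : WGCL M St → WGCL M St → WGCL M St
  | weight : M → WGCL M St
  | wloop : Set St → WGCL M St → WGCL M St

section Transformers

variable {M S St : Type} [Monoid M]

/-- Iverson-bracket guarding `[φ] ⋄ f`. -/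
noncomputable def iv (mm : MonModule M S) (φ : Set St) (f : St → S) : St → S :=
  fun σ => @ite _ (σ ∈ φ) (Classical.propDecidable _) (f σ) mm.zero

/-- Least fixed point of `Φ` w.r.t. the pointwise natural order (chosen by classical choice
if it exists; arbitrary otherwise). -/
noncomputable def wlfp (mm : MonModule M S) (Φ : (St → S) → St → S) : St → S :=
  @dite _ (∃ x : St → S, Φ x = x ∧ ∀ y : St → S, Φ y = y → wle mm x y)
    (Classical.propDecidable _) (fun h => h.choose) (fun _ => fun _ => mm.zero)

/-- Greatest fixed point of `Φ` w.r.t. the pointwise natural order. -/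
noncomputable def wgfp (mm : MonModule M S) (Φ : (St → S) → St → S) : St → S :=
  @dite _ (∃ x : St → S, Φ x = x ∧ ∀ y : St → S, Φ y = y → wle mm y x)
    (Classical.propDecidable _) (fun h => h.choose) (fun _ => fun _ => mm.zero)

/-- Weakest preweighting transformer `wp`. -/
noncomputable def wp (mm : MonModule M S) : WGCL M St → (St → S) → St → S
  | WGCL.assign g => fun f σ => f (g σ)
  | WGCL.seq C₁ C₂ => fun f => wp mm C₁ (wp mm C₂ f)
  | WGCL.ite φ C₁ C₂ => fun f σ => mm.add (iv mm φ (wp mm C₁ f) σ) (iv mm φᶜ (wp mm C₂ f) σ)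
  | WGCL.branch C₁ C₂ => fun f σ => mm.add (wp mm C₁ f σ) (wp mm C₂ f σ)
  | WGCL.weight a => fun f σ => mm.smul a (f σ)
  | WGCL.wloop φ C' => fun f =>
      wlfp mm (fun X σ => mm.add (iv mm φᶜ f σ) (iv mm φ (wp mm C' X) σ))

/-- The `wp`-characteristic function `Φ_f(X) = [¬φ]⋄f ⊕ [φ]⋄wp[C'](X)` of `while(φ){C'}`. -/
noncomputable def charW (mm : MonModule M S) (φ : Set St) (C' : WGCL M St) (f : St → S)
    (X : St → S) : St → S :=
  fun σ => mm.add (iv mm φᶜ f σ) (iv mm φ (wp mm C' X) σ)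

/-- Weakest liberal preweighting transformer `wlp`. -/
noncomputable def wlp (mm : MonModule M S) : WGCL M St → (St → S) → St → S
  | WGCL.assign g => fun f σ => f (g σ)
  | WGCL.seq C₁ C₂ => fun f => wlp mm C₁ (wlp mm C₂ f)
  | WGCL.ite φ C₁ C₂ => fun f σ => mm.add (iv mm φ (wlp mm C₁ f) σ) (iv mm φᶜ (wlp mm C₂ f) σ)
  | WGCL.branch C₁ C₂ => fun f σ => mm.add (wlp mm C₁ f σ) (wlp mm C₂ f σ)
  | WGCL.weight a => fun f σ => mm.smul a (f σ)
  | WGCL.wloop φ C' => fun f =>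
      wgfp mm (fun X σ => mm.add (iv mm φᶜ f σ) (iv mm φ (wlp mm C' X) σ))

/-- The `wlp`-characteristic function `Ψ_f(X) = [¬φ]⋄f ⊕ [φ]⋄wlp[C'](X)` of `while(φ){C'}`. -/
noncomputable def charWlp (mm : MonModule M S) (φ : Set St) (C' : WGCL M St) (f : St → S)
    (X : St → S) : St → S :=
  fun σ => mm.add (iv mm φᶜ f σ) (iv mm φ (wlp mm C' X) σ)

end Transformers

/-! ## Operational semantics -/

/-- Configurations: `none` is a terminal configuration. -/
abbrev Conf (M St : Type) := Option (WGCL M St) × St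

section Operational

variable {M St : Type} [Monoid M]

/-- Weighted small-step operational semantics: each transition carries a weight in `M`
(the weight `a` for executing `⊙ a`, and `1` otherwise). -/
inductive Step : Conf M St → M → Conf M St → Prop
  | assign (g : St → St) (σ : St) : Step (some (WGCL.assign g), σ) 1 (none, g σ)
  | weight (a : M) (σ : St) : Step (some (WGCL.weight a), σ) a (none, σ)
  | seq_fin {C₁ : WGCL M St} {σ : St} {w : M} {σ' : St} (C₂ : WGCL M St) :
      Step (some C₁, σ) w (none, σ') → Step (some (WGCL.seq C₁ C₂), σ) w (some C₂, σ')
  | seq_step {C₁ : WGCL M St} {σ : St} {w : M} {C₁' : WGCL M St} {σ' : St} (C₂ : WGCL M St) :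
      Step (some C₁, σ) w (some C₁', σ') →
      Step (some (WGCL.seq C₁ C₂), σ) w (some (WGCL.seq C₁' C₂), σ')
  | ite_left {φ : Set St} {σ : St} (C₁ C₂ : WGCL M St) :
      σ ∈ φ → Step (some (WGCL.ite φ C₁ C₂), σ) 1 (some C₁, σ)
  | ite_right {φ : Set St} {σ : St} (C₁ C₂ : WGCL M St) :
      σ ∉ φ → Step (some (WGCL.ite φ C₁ C₂), σ) 1 (some C₂, σ)
  | branch_left (C₁ C₂ : WGCL M St) (σ : St) :
      Step (some (WGCL.branch C₁ C₂), σ) 1 (some C₁, σ)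
  | branch_right (C₁ C₂ : WGCL M St) (σ : St) :
      Step (some (WGCL.branch C₁ C₂), σ) 1 (some C₂, σ)
  | loop_enter {φ : Set St} {σ : St} (C : WGCL M St) :
      σ ∈ φ → Step (some (WGCL.wloop φ C), σ) 1 (some (WGCL.seq C (WGCL.wloop φ C)), σ)
  | loop_exit {φ : Set St} {σ : St} (C : WGCL M St) :
      σ ∉ φ → Step (some (WGCL.wloop φ C), σ) 1 (none, σ)

/-- A finite computation path from configuration `c`, recorded as the list of
(transition weight, successor configuration) pairs. -/
inductive Steps : Conf M St → List (M × Conf M St) → Prop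
  | nil (c : Conf M St) : Steps c []
  | cons {c : Conf M St} {w : M} {c' : Conf M St} {l : List (M × Conf M St)} :
      Step c w c' → Steps c' l → Steps c ((w, c') :: l)

/-- Weight of a computation path: the ordered product of its transition weights. -/
def pathWeight (l : List (M × Conf M St)) : M := (l.map Prod.fst).prod

/-- Final state of a (nonempty) computation path; `σ` for the empty path. -/
def lastState (σ : St) (l : List (M × Conf M St)) : St :=
  (l.getLastD ((1 : M), ((none : Option (WGCL M St)), σ))).2.2

/-- A terminating computation path from `c`: a finite path ending in a terminal
configuration. -/
def TermPath (c : Conf M St) (l : List (M × Conf M St)) : Prop :=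
  Steps c l ∧ ∃ p : M × Conf M St, l.getLast? = some p ∧ p.2.1 = (none : Option (WGCL M St))

/-- There is an infinite computation path starting in `c`. -/
def InfinitePathFrom (c : Conf M St) : Prop :=
  ∃ π : ℕ → Conf M St, π 0 = c ∧ ∀ n : ℕ, ∃ w : M, Step (π n) w (π (n + 1))

end Operational

/-! ## Countable module sums as suprema of finite partial sums -/

section Sums

variable {M S : Type} [Monoid M]

/-- Finite sum of `g` over the elements of a list. -/
def finListSum (mm : MonModule M S) {ι : Type} (g : ι → S) : List ι → S
  | [] => mm.zero
  | i :: t => mm.add (g i) (finListSum mm g t)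

/-- `x` is the (countable) module sum `⨁_{i ∈ T} g i`, i.e. the least upper bound
of all finite partial sums over duplicate-free lists of elements of `T`. -/
def IsSumOver (mm : MonModule M S) {ι : Type} (T : Set ι) (g : ι → S) (x : S) : Prop :=
  (∀ l : List ι, l.Nodup → (∀ i ∈ l, i ∈ T) → mm.le (finListSum mm g l) x) ∧
  ∀ y : S, (∀ l : List ι, l.Nodup → (∀ i ∈ l, i ∈ T) → mm.le (finListSum mm g l) y) → mm.le x y

end Sums

namespace MonModule

variable {M S : Type} [Monoid M] {mm : MonModule M S}

theorem le_refl (a : S) : mm.le a a := ⟨mm.zero, mm.add_zero a⟩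

theorem le_trans {a b c : S} (hab : mm.le a b) (hbc : mm.le b c) : mm.le a c := by
  obtain ⟨d, rfl⟩ := hab
  obtain ⟨e, rfl⟩ := hbc
  exact ⟨mm.add d e, (mm.add_assoc _ _ _).symm⟩

theorem zero_le (a : S) : mm.le mm.zero a := ⟨a, by rw [mm.add_comm, mm.add_zero]⟩

theorem add_add_add_comm (a b c d : S) :
    mm.add (mm.add a b) (mm.add c d) = mm.add (mm.add a c) (mm.add b d) := by
  rw [mm.add_assoc, ← mm.add_assoc b, mm.add_comm b c, mm.add_assoc c, ← mm.add_assoc a]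

theorem add_le_add {a b c d : S} (hab : mm.le a b) (hcd : mm.le c d) :
    mm.le (mm.add a c) (mm.add b d) := by
  obtain ⟨e, rfl⟩ := hab
  obtain ⟨k, rfl⟩ := hcd
  exact ⟨mm.add e k, add_add_add_comm _ _ _ _⟩

theorem Chain.le_of_le {s : ℕ → S} (hs : mm.Chain s) {m n : ℕ} (h : m ≤ n) :
    mm.le (s m) (s n) := by
  induction h with
  | refl => exact le_refl _
  | step _ ih => exact le_trans ih (hs _)

theorem isSup_const (a : S) : mm.IsSup (fun _ => a) a :=
  ⟨fun _ => le_refl a, fun _ h => h 0⟩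

theorem IsSup.unique (hord : mm.NaturallyOrdered) {s : ℕ → S} {x y : S}
    (hx : mm.IsSup s x) (hy : mm.IsSup s y) : x = y :=
  hord _ _ (hx.2 _ hy.1) (hy.2 _ hx.1)

theorem IsSup.shift {s : ℕ → S} {x : S} (hs : mm.Chain s) (hx : mm.IsSup s x) :
    mm.IsSup (fun n => s (n + 1)) x :=
  ⟨fun n => hx.1 (n + 1), fun _ h => hx.2 _ fun n => le_trans (hs n) (h n)⟩

theorem IsSup.add (hcont : OmegaContinuous mm) {s t : ℕ → S} {x y : S}
    (hs : mm.Chain s) (ht : mm.Chain t) (hx : mm.IsSup s x) (hy : mm.IsSup t y) :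
    mm.IsSup (fun n => mm.add (s n) (t n)) (mm.add x y) := by
  refine ⟨fun n => add_le_add (hx.1 n) (hy.1 n), fun z hz => ?_⟩
  rw [mm.add_comm]
  refine (hcont.add_cont y s x hs hx).2 z fun n => ?_
  change mm.le (mm.add y (s n)) z
  rw [mm.add_comm]
  refine (hcont.add_cont (s n) t y ht hy).2 z fun m => ?_
  exact le_trans (add_le_add (hs.le_of_le (le_max_left n m)) (ht.le_of_le (le_max_right n m)))
    (hz (max n m))

end MonModule

section Transformers

open MonModule

variable {M S St : Type} [Monoid M] {mm : MonModule M S}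

/-- A weighting transformer that is additive and preserves pointwise suprema of ω-chains. -/
structure IsAdditiveContinuous (mm : MonModule M S) (T : (St → S) → St → S) : Prop where
  map_add : ∀ f g : St → S, T (fun σ => mm.add (f σ) (g σ)) = fun σ => mm.add (T f σ) (T g σ)
  map_isSup : ∀ (s : ℕ → St → S) (x : St → S), WChain mm s →
    (∀ σ, mm.IsSup (fun n => s n σ) (x σ)) → ∀ σ, mm.IsSup (fun n => T (s n) σ) (T x σ)

namespace IsAdditiveContinuous

variable {T U : (St → S) → St → S}

theorem mono (hT : IsAdditiveContinuous mm T) {f g : St → S} (hfg : wle mm f g) :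
    wle mm (T f) (T g) := by
  choose c hc using hfg
  obtain rfl : (fun σ => mm.add (f σ) (c σ)) = g := funext hc
  rw [hT.map_add]
  exact fun σ => ⟨T c σ, rfl⟩

theorem map_chain (hT : IsAdditiveContinuous mm T) {s : ℕ → St → S} (hs : WChain mm s) :
    WChain mm fun n => T (s n) :=
  fun n => hT.mono (hs n)

theorem const_zero : IsAdditiveContinuous mm fun (_ : St → S) (_ : St) => mm.zero :=
  ⟨fun _ _ => funext fun _ => (mm.add_zero _).symm, fun _ _ _ _ _ => isSup_const _⟩

theorem comp (hT : IsAdditiveContinuous mm T) (hU : IsAdditiveContinuous mm U) :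
    IsAdditiveContinuous mm fun f => T (U f) where
  map_add f g := by rw [hU.map_add, hT.map_add]
  map_isSup _ _ hs hx := hT.map_isSup _ _ (hU.map_chain hs) (hU.map_isSup _ _ hs hx)

theorem add (hcont : OmegaContinuous mm) (hT : IsAdditiveContinuous mm T)
    (hU : IsAdditiveContinuous mm U) :
    IsAdditiveContinuous mm fun f σ => mm.add (T f σ) (U f σ) where
  map_add f g := by
    funext σ
    rw [hT.map_add, hU.map_add]
    exact add_add_add_comm _ _ _ _
  map_isSup _ _ hs hx σ :=
    IsSup.add hcont (fun n => hT.map_chain hs n σ) (fun n => hU.map_chain hs n σ)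
      (hT.map_isSup _ _ hs hx σ) (hU.map_isSup _ _ hs hx σ)

theorem guard (φ : Set St) : IsAdditiveContinuous mm (iv mm φ) where
  map_add f g := by
    funext σ
    by_cases hσ : σ ∈ φ
    · simp [iv, hσ]
    · simp [iv, hσ, mm.add_zero]
  map_isSup s x _ hx σ := by
    by_cases hσ : σ ∈ φ
    · simpa [iv, hσ] using hx σ
    · simpa [iv, hσ] using isSup_const mm.zero

theorem assign (u : St → St) : IsAdditiveContinuous mm fun (f : St → S) σ => f (u σ) :=
  ⟨fun _ _ => rfl, fun _ _ _ hx σ => hx (u σ)⟩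

theorem weight (hcont : OmegaContinuous mm) (a : M) :
    IsAdditiveContinuous mm fun (f : St → S) σ => mm.smul a (f σ) :=
  ⟨fun _ _ => funext fun _ => mm.smul_add _ _ _,
    fun _ _ hs hx σ => hcont.smul_cont a _ _ (fun n => hs n σ) (hx σ)⟩

/-- Pointwise suprema of ω-chains of transformers. -/
theorem iSup (hord : mm.NaturallyOrdered) (hcont : OmegaContinuous mm)
    {V : ℕ → (St → S) → St → S} (hV : ∀ n, IsAdditiveContinuous mm (V n))
    (hchain : ∀ f, WChain mm fun n => V n f)
    (hT : ∀ f σ, mm.IsSup (fun n => V n f σ) (T f σ)) : IsAdditiveContinuous mm T := by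
  have hadd : ∀ f g : St → S,
      T (fun σ => mm.add (f σ) (g σ)) = fun σ => mm.add (T f σ) (T g σ) := by
    refine fun f g => funext fun σ => (hT _ σ).unique hord ?_
    simp only [(hV _).map_add]
    exact IsSup.add hcont (fun n => hchain f n σ) (fun n => hchain g n σ) (hT f σ) (hT g σ)
  refine ⟨hadd, fun s x hs hx σ => ⟨fun n => ?_, fun z hz => ?_⟩⟩
  · exact (hT (s n) σ).2 _ fun k =>
      le_trans ((hV k).mono (fun τ => (hx τ).1 n) σ) ((hT x σ).1 k)
  · exact (hT x σ).2 z fun k => ((hV k).map_isSup s x hs hx σ).2 z fun n =>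
      le_trans ((hT (s n) σ).1 k) (hz n)

end IsAdditiveContinuous

theorem wlfp_eq (hord : mm.NaturallyOrdered) {Φ : (St → S) → St → S} {x : St → S}
    (hx : Φ x = x) (hle : ∀ y, Φ y = y → wle mm x y) : wlfp mm Φ = x := by
  have h : ∃ x, Φ x = x ∧ ∀ y, Φ y = y → wle mm x y := ⟨x, hx, hle⟩
  rw [wlfp, dif_pos h]
  exact funext fun σ => hord _ _ (h.choose_spec.2 x hx σ) (hle _ h.choose_spec.1 σ)

/-- Kleene iterates of the loop `while(φ){C}` whose body has semantics `T`. -/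
noncomputable def loopIter (mm : MonModule M S) (φ : Set St) (T : (St → S) → St → S) :
    ℕ → (St → S) → St → S
  | 0 => fun _ _ => mm.zero
  | n + 1 => fun f σ => mm.add (iv mm φᶜ f σ) (iv mm φ (T (loopIter mm φ T n f)) σ)

variable {T : (St → S) → St → S}

theorem loopIter_isAdditiveContinuous (hcont : OmegaContinuous mm) (φ : Set St)
    (hT : IsAdditiveContinuous mm T) (n : ℕ) : IsAdditiveContinuous mm (loopIter mm φ T n) := by
  induction n with
  | zero => exact .const_zero
  | succ n ih => exact .add hcont (.guard _) (.comp (.guard _) (hT.comp ih))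

theorem loopBody_mono (φ : Set St) (hT : IsAdditiveContinuous mm T) (f : St → S)
    {X Y : St → S} (hXY : wle mm X Y) :
    wle mm (fun σ => mm.add (iv mm φᶜ f σ) (iv mm φ (T X) σ))
      (fun σ => mm.add (iv mm φᶜ f σ) (iv mm φ (T Y) σ)) :=
  fun σ => add_le_add (le_refl _) ((IsAdditiveContinuous.guard φ).mono (hT.mono hXY) σ)

theorem loopIter_chain (φ : Set St) (hT : IsAdditiveContinuous mm T) (f : St → S) :
    WChain mm fun n => loopIter mm φ T n f := by
  intro n
  induction n with
  | zero => exact fun σ => zero_le _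
  | succ n ih => exact loopBody_mono φ hT f ih

theorem isSup_loopIter_wlfp (hord : mm.NaturallyOrdered) (hcont : OmegaContinuous mm)
    (φ : Set St) (hT : IsAdditiveContinuous mm T) (f : St → S) (σ : St) :
    mm.IsSup (fun n => loopIter mm φ T n f σ)
      (wlfp mm (fun X σ => mm.add (iv mm φᶜ f σ) (iv mm φ (T X) σ)) σ) := by
  have hchain := loopIter_chain φ hT f
  choose x hx using fun τ => hcont.sup_exists _ fun n => hchain n τ
  rw [wlfp_eq hord (x := x)]
  · exact hx σ
  · have hG : IsAdditiveContinuous mm fun X => iv mm φ (T X) := .comp (.guard φ) hT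
    funext τ
    exact (hcont.add_cont _ _ _ (fun n => hG.map_chain hchain n τ)
      (hG.map_isSup _ _ hchain hx τ)).unique hord ((hx τ).shift fun n => hchain n τ)
  · intro y hy τ
    refine (hx τ).2 _ fun n => ?_
    suffices h : wle mm (loopIter mm φ T n f) y from h τ
    induction n with
    | zero => exact fun _ => zero_le _
    | succ n ih =>
      rw [← hy]
      exact loopBody_mono φ hT f ih

theorem wp_isAdditiveContinuous (hord : mm.NaturallyOrdered) (hcont : OmegaContinuous mm)
    (C : WGCL M St) : IsAdditiveContinuous mm (wp mm C) := by
  induction C with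
  | assign u => exact .assign u
  | seq C₁ C₂ ih₁ ih₂ => exact ih₁.comp ih₂
  | ite φ C₁ C₂ ih₁ ih₂ => exact .add hcont (.comp (.guard φ) ih₁) (.comp (.guard φᶜ) ih₂)
  | branch C₁ C₂ ih₁ ih₂ => exact ih₁.add hcont ih₂
  | weight a => exact .weight hcont a
  | wloop φ C ih =>
    exact .iSup hord hcont (loopIter_isAdditiveContinuous hcont φ ih)
      (loopIter_chain φ ih) (isSup_loopIter_wlfp hord hcont φ ih)

end Transformers

/-- **Additivity of wp**: for a naturally ordered ω-continuous `M`-module `S`,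
`wp[C](f ⊕ g) = wp[C](f) ⊕ wp[C](g)`. -/
theorem wp_additive (M S St : Type) [Monoid M] [Countable St] (mm : MonModule M S)
    (hord : mm.NaturallyOrdered) (hcont : OmegaContinuous mm) :
    ∀ (C : WGCL M St) (f g : St → S),
      wp mm C (fun σ => mm.add (f σ) (g σ)) = fun σ => mm.add (wp mm C f σ) (wp mm C g σ) :=
  fun C => (wp_isAdditiveContinuous hord hcont C).map_add
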